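/- arXiv:1812.08584 — 2 statements merged into one kernel-verified Lean document; each statement's English description precedes it below -/
import Mathlib

section
/- Let X be a metric space and f : X → X a contraction. Then Zadeh's extension f̃ is nonexpansive for the Skorokhod metric: for all u, v ∈ 𝔉(X), d_0(f̃(u), f̃(v)) ≤ d_0(u, v). -/
open Set Metric Filter
open scoped Classical

noncomputable section

/-- The `α`-cut `[u]_α = {x | u x ≥ α}` of a fuzzy set for `α ∈ (0,1]`,
and its support `[u]_0 = closure {x | u x > 0}` for `α = 0`. -/
def fcut {X : Type*} [TopologicalSpace X] (u : X → ℝ) (α : ℝ) : Set X :=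
  if α = 0 then closure {x | 0 < u x} else {x | α ≤ u x}

/-- `u ∈ 𝔉(X)`: an upper semicontinuous fuzzy set (with values in `[0,1]`)
whose support is compact and whose `1`-cut is nonempty. -/
def IsFuzzy {X : Type*} [TopologicalSpace X] (u : X → ℝ) : Prop :=
  UpperSemicontinuous u ∧ (∀ x, u x ∈ Icc (0 : ℝ) 1) ∧
    IsCompact (fcut u 0) ∧ (fcut u 1).Nonempty

/-- The level-wise metric `d_∞(u,v) = sup{d_H([u]_α, [v]_α) : α ∈ [0,1]}`. -/
def dInfty {X : Type*} [MetricSpace X] (u v : X → ℝ) : ℝ :=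
  ⨆ α : Icc (0 : ℝ) 1, hausdorffDist (fcut u α.1) (fcut v α.1)

/-- `t ∈ Hom(I)`: a strictly increasing homeomorphism of `I = [0,1]` onto itself
(recorded as a map `ℝ → ℝ`, considered on `[0,1]`). -/
def IsHomI (t : ℝ → ℝ) : Prop :=
  StrictMonoOn t (Icc 0 1) ∧ ContinuousOn t (Icc 0 1) ∧
    MapsTo t (Icc 0 1) (Icc 0 1) ∧ SurjOn t (Icc 0 1) (Icc 0 1)

/-- The Skorokhod metric
`d_0(u,v) = inf{ε > 0 : ∃ t ∈ Hom(I), sup_{x ∈ I} |t x - x| ≤ ε and d_∞(u, t∘v) ≤ ε}`. -/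
def dSk {X : Type*} [MetricSpace X] (u v : X → ℝ) : ℝ :=
  sInf {ε : ℝ | 0 < ε ∧ ∃ t : ℝ → ℝ, IsHomI t ∧
    (∀ x ∈ Icc (0 : ℝ) 1, |t x - x| ≤ ε) ∧ dInfty u (t ∘ v) ≤ ε}

/-- Zadeh's extension of `f`: `f̃(u)(x) = sup{u z : z ∈ f⁻¹(x)}`, which is `0`
when `f⁻¹(x) = ∅` since `sSup ∅ = 0` in `ℝ`. -/
def zadeh {X : Type*} (f : X → X) (u : X → ℝ) : X → ℝ :=
  fun x => sSup (u '' (f ⁻¹' {x}))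

theorem IsHomI.map_zero {t : ℝ → ℝ} (ht : IsHomI t) : t 0 = 0 := by
  obtain ⟨hmono, -, hmaps, hsurj⟩ := ht
  obtain ⟨a, ha, hta⟩ := hsurj (left_mem_Icc.2 zero_le_one)
  have h0 := hmono.monotoneOn (left_mem_Icc.2 zero_le_one) ha ha.1
  exact le_antisymm (h0.trans_eq hta) (hmaps (left_mem_Icc.2 zero_le_one)).1

theorem isHomI_id : IsHomI id :=
  ⟨strictMono_id.strictMonoOn _, continuousOn_id, mapsTo_id _, surjOn_id _⟩

theorem fcut_zero {X : Type*} [TopologicalSpace X] (u : X → ℝ) :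
    fcut u 0 = closure {x | 0 < u x} := if_pos rfl

theorem fcut_of_ne_zero {X : Type*} [TopologicalSpace X] (u : X → ℝ) {α : ℝ} (hα : α ≠ 0) :
    fcut u α = {x | α ≤ u x} := if_neg hα

/-- Reparametrizing a fuzzy set by `t ∈ Hom(I)` reparametrizes its cuts. -/
theorem IsHomI.fcut_comp {X : Type*} [TopologicalSpace X] {t : ℝ → ℝ} (ht : IsHomI t)
    {w : X → ℝ} (hw : ∀ x, w x ∈ Icc (0 : ℝ) 1) {β : ℝ} (hβ : β ∈ Icc (0 : ℝ) 1) :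
    fcut (t ∘ w) (t β) = fcut w β := by
  have h0 : (0 : ℝ) ∈ Icc (0 : ℝ) 1 := left_mem_Icc.2 zero_le_one
  rcases eq_or_ne β 0 with rfl | hne
  · rw [ht.map_zero, fcut_zero, fcut_zero]
    congr 1
    ext x
    simpa [ht.map_zero] using ht.1.lt_iff_lt h0 (hw x)
  · have htβ : t β ≠ 0 := fun h => hne (ht.1.injOn hβ h0 (h.trans ht.map_zero.symm))
    rw [fcut_of_ne_zero _ htβ, fcut_of_ne_zero _ hne]
    ext x
    exact ht.1.le_iff_le hβ (hw x)

theorem fcut_subset_fcut_zero {X : Type*} [TopologicalSpace X] (u : X → ℝ) {α : ℝ}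
    (hα : 0 ≤ α) : fcut u α ⊆ fcut u 0 := by
  rcases hα.eq_or_lt with rfl | hpos
  · rfl
  · rw [fcut_zero, fcut_of_ne_zero _ hpos.ne']
    exact fun x hx => subset_closure (hpos.trans_le hx)

theorem fcut_one_subset_fcut {X : Type*} [TopologicalSpace X] (u : X → ℝ) {α : ℝ}
    (hα : α ≤ 1) : fcut u 1 ⊆ fcut u α := by
  rcases eq_or_ne α 0 with rfl | hne
  · exact fcut_subset_fcut_zero u zero_le_one
  · rw [fcut_of_ne_zero _ one_ne_zero, fcut_of_ne_zero _ hne]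
    exact fun x hx => hα.trans hx

theorem IsFuzzy.fcut_nonempty {X : Type*} [TopologicalSpace X] {u : X → ℝ} (hu : IsFuzzy u)
    {α : ℝ} (hα : α ≤ 1) : (fcut u α).Nonempty :=
  hu.2.2.2.mono (fcut_one_subset_fcut u hα)

theorem IsFuzzy.isBounded_fcut {X : Type*} [MetricSpace X] {u : X → ℝ} (hu : IsFuzzy u)
    {α : ℝ} (hα : 0 ≤ α) : Bornology.IsBounded (fcut u α) :=
  hu.2.2.1.isBounded.subset (fcut_subset_fcut_zero u hα)

theorem bddAbove_image_of_mem_Icc {X : Type*} {u : X → ℝ} (hu : ∀ x, u x ∈ Icc (0 : ℝ) 1)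
    (s : Set X) : BddAbove (u '' s) :=
  ⟨1, forall_mem_image.2 fun x _ => (hu x).2⟩

theorem le_zadeh_apply {X : Type*} (f : X → X) {u : X → ℝ} (hu : ∀ x, u x ∈ Icc (0 : ℝ) 1)
    (z : X) : u z ≤ zadeh f u (f z) :=
  le_csSup (bddAbove_image_of_mem_Icc hu _) (mem_image_of_mem u rfl)

theorem zadeh_mem_Icc {X : Type*} (f : X → X) {u : X → ℝ} (hu : ∀ x, u x ∈ Icc (0 : ℝ) 1)
    (x : X) : zadeh f u x ∈ Icc (0 : ℝ) 1 :=
  ⟨Real.sSup_nonneg (forall_mem_image.2 fun z _ => (hu z).1),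
    Real.sSup_le (forall_mem_image.2 fun z _ => (hu z).2) zero_le_one⟩

theorem exists_lt_of_lt_zadeh {X : Type*} {f : X → X} {u : X → ℝ} {x : X} {a : ℝ} (ha : 0 ≤ a)
    (h : a < zadeh f u x) : ∃ z, f z = x ∧ a < u z := by
  have hne : (u '' (f ⁻¹' {x})).Nonempty := by
    by_contra hempty
    rw [not_nonempty_iff_eq_empty] at hempty
    rw [zadeh, hempty, Real.sSup_empty] at h
    exact ha.not_gt h
  obtain ⟨_, ⟨z, hz, rfl⟩, hlt⟩ := exists_lt_of_lt_csSup hne h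
  exact ⟨z, hz, hlt⟩

/-- A positive value of Zadeh's extension is attained on the fibre. -/
theorem IsFuzzy.exists_zadeh_eq {X : Type*} [TopologicalSpace X] [T1Space X] {f : X → X}
    (hf : Continuous f) {u : X → ℝ} (hu : IsFuzzy u) {x : X} (hx : 0 < zadeh f u x) :
    ∃ z, f z = x ∧ u z = zadeh f u x := by
  obtain ⟨z, hz, hpos⟩ := exists_lt_of_lt_zadeh le_rfl hx
  have hsupp : ∀ y, 0 < u y → y ∈ fcut u 0 := fun y hy => by
    rw [fcut_zero]; exact subset_closure hy
  obtain ⟨m, ⟨-, hm⟩, hmax⟩ := UpperSemicontinuousOn.exists_isMaxOn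
    (s := fcut u 0 ∩ f ⁻¹' {x}) ⟨z, hsupp z hpos, hz⟩
    (hu.2.2.1.inter_right (isClosed_singleton.preimage hf)) (hu.1.upperSemicontinuousOn _)
  refine ⟨m, hm, le_antisymm (hm ▸ le_zadeh_apply f hu.2.1 m) ?_⟩
  refine csSup_le ⟨_, mem_image_of_mem u hz⟩ (forall_mem_image.2 fun y hy => ?_)
  by_cases hy0 : 0 < u y
  · exact hmax ⟨hsupp y hy0, hy⟩
  · exact (not_lt.1 hy0).trans (hu.2.1 m).1

/-- The cuts of Zadeh's extension are the images of the cuts. -/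
theorem IsFuzzy.fcut_zadeh {X : Type*} [MetricSpace X] {f : X → X}
    (hf : Continuous f) {u : X → ℝ} (hu : IsFuzzy u) {α : ℝ} (hα : 0 ≤ α) :
    fcut (zadeh f u) α = f '' fcut u α := by
  rcases hα.eq_or_lt with rfl | hpos
  · have himage : {x | 0 < zadeh f u x} = f '' {z | 0 < u z} := by
      ext x
      constructor
      · intro hx
        obtain ⟨z, hz, hlt⟩ := exists_lt_of_lt_zadeh le_rfl hx
        exact ⟨z, hlt, hz⟩
      · rintro ⟨z, hz, rfl⟩
        exact lt_of_lt_of_le hz (le_zadeh_apply f hu.2.1 z)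
    have hcompact := hu.2.2.1
    rw [fcut_zero] at hcompact
    rw [fcut_zero, fcut_zero, himage]
    exact (closure_minimal (image_mono subset_closure)
      (hcompact.image hf).isClosed).antisymm (image_closure_subset_closure_image hf)
  · rw [fcut_of_ne_zero _ hpos.ne', fcut_of_ne_zero _ hpos.ne']
    ext x
    constructor
    · intro hx
      obtain ⟨z, hz, heq⟩ := hu.exists_zadeh_eq hf (hpos.trans_le hx)
      exact ⟨z, le_of_le_of_eq hx heq.symm, hz⟩
    · rintro ⟨z, hz, rfl⟩
      exact le_trans hz (le_zadeh_apply f hu.2.1 z)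

theorem hausdorffDist_image_le {X Y : Type*} [PseudoMetricSpace X] [PseudoMetricSpace Y]
    {f : X → Y} (hf : LipschitzWith 1 f) {s t : Set X} (hfin : hausdorffEDist s t ≠ ⊤) :
    hausdorffDist (f '' s) (f '' t) ≤ hausdorffDist s t := by
  refine le_of_forall_gt_imp_ge_of_dense fun r hr => ?_
  refine hausdorffDist_le_of_mem_dist (hausdorffDist_nonneg.trans hr.le) ?_ ?_
  · rintro _ ⟨x, hx, rfl⟩
    obtain ⟨y, hy, hxy⟩ := exists_dist_lt_of_hausdorffDist_lt hx hr hfin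
    exact ⟨f y, mem_image_of_mem f hy, (hf.dist_le_mul x y).trans (by simpa using hxy.le)⟩
  · rintro _ ⟨y, hy, rfl⟩
    obtain ⟨x, hx, hxy⟩ := exists_dist_lt_of_hausdorffDist_lt' hy hr hfin
    rw [dist_comm] at hxy
    exact ⟨f x, mem_image_of_mem f hx, (hf.dist_le_mul y x).trans (by simpa using hxy.le)⟩

theorem IsFuzzy.bddAbove_hausdorffDist_comp {X : Type*} [MetricSpace X] {u v : X → ℝ}
    (hu : IsFuzzy u) (hv : IsFuzzy v) {t : ℝ → ℝ} (ht : IsHomI t) :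
    BddAbove (range fun α : Icc (0 : ℝ) 1 =>
      hausdorffDist (fcut u α.1) (fcut (t ∘ v) α.1)) := by
  refine ⟨diam (fcut u 0 ∪ fcut v 0), forall_mem_range.2 ?_⟩
  rintro ⟨α, hα⟩
  obtain ⟨β, hβ, rfl⟩ := ht.2.2.2 hα
  simp only [ht.fcut_comp hv.2.1 hβ]
  refine (hausdorffDist_le_diam (hu.fcut_nonempty hα.2) (hu.isBounded_fcut hα.1)
    (hv.fcut_nonempty hβ.2) (hv.isBounded_fcut hβ.1)).trans ?_
  exact diam_mono (union_subset_union (fcut_subset_fcut_zero u hα.1)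
    (fcut_subset_fcut_zero v hβ.1)) ((hu.isBounded_fcut le_rfl).union (hv.isBounded_fcut le_rfl))

theorem IsFuzzy.dInfty_zadeh_comp_le {X : Type*} [MetricSpace X] {f : X → X}
    (hf : LipschitzWith 1 f) {u v : X → ℝ} (hu : IsFuzzy u) (hv : IsFuzzy v) {t : ℝ → ℝ}
    (ht : IsHomI t) : dInfty (zadeh f u) (t ∘ zadeh f v) ≤ dInfty u (t ∘ v) := by
  have : Nonempty (Icc (0 : ℝ) 1) := ⟨0, left_mem_Icc.2 zero_le_one⟩
  refine ciSup_mono (hu.bddAbove_hausdorffDist_comp hv ht) ?_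
  rintro ⟨α, hα⟩
  obtain ⟨β, hβ, rfl⟩ := ht.2.2.2 hα
  simp only [ht.fcut_comp hv.2.1 hβ, ht.fcut_comp (zadeh_mem_Icc f hv.2.1) hβ,
    hu.fcut_zadeh hf.continuous hα.1, hv.fcut_zadeh hf.continuous hβ.1]
  exact hausdorffDist_image_le hf (hausdorffEDist_ne_top_of_nonempty_of_bounded
    (hu.fcut_nonempty hα.2) (hv.fcut_nonempty hβ.2) (hu.isBounded_fcut hα.1)
    (hv.isBounded_fcut hβ.1))

/-- If `f : X → X` is a contraction, then Zadeh's extension `f̃` is nonexpansive for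
the Skorokhod metric: `d_0(f̃(u), f̃(v)) ≤ d_0(u, v)` for all `u, v ∈ 𝔉(X)`. -/
theorem statement6 {X : Type*} [MetricSpace X] (f : X → X)
    (hf : ∃ l : ℝ, 0 ≤ l ∧ l < 1 ∧ ∀ x y : X, dist (f x) (f y) ≤ l * dist x y)
    (u v : X → ℝ) (hu : IsFuzzy u) (hv : IsFuzzy v) :
    dSk (zadeh f u) (zadeh f v) ≤ dSk u v := by
  obtain ⟨l, -, hl1, hl⟩ := hf
  have hlip : LipschitzWith 1 f := LipschitzWith.of_dist_le_mul fun x y => by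
    simpa using (hl x y).trans (mul_le_of_le_one_left dist_nonneg hl1.le)
  refine csInf_le_csInf ⟨0, fun ε hε => hε.1.le⟩ ?_ ?_
  · refine ⟨max 1 (dInfty u (id ∘ v)), lt_max_of_lt_left one_pos, id, isHomI_id,
      fun x _ => ?_, le_max_right _ _⟩
    simp
  · rintro ε ⟨hε, t, ht, htε, hd⟩
    exact ⟨hε, t, ht, htε, (hu.dInfty_zadeh_comp_le hlip hv ht).trans hd⟩
end
end

section
/- For the fuzzy sets u, v of the Example on I = [0,1] and the piecewise-linear homeomorphism t ∈ Hom(I) given by t(x) = 3x for x ∈ [0, 1/8], t(x) = x/2 + 5/16 for x ∈ [1/8, 5/8], and t(x) = x for x ∈ [5/8, 1]: one has sup{|t(x) − x| : x ∈ I} = 1/4 and d_∞(u, t∘v) = 1/4. -/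
open Set Metric Filter
open scoped Classical

noncomputable section

/-- The unit interval `I = [0,1]` as a metric space. -/
abbrev I01 : Type := Set.Icc (0 : ℝ) 1

/-- `a_n = 1 - (5/8)/2^n` (so `a_0 = 3/8`). -/
def aSeq (n : ℕ) : ℝ := 1 - 5 / 8 / 2 ^ n

/-- `a'_0 = 3/8` and `a'_n = 1 - (1/4)/2^n` for `n ≥ 1` (so `a'_1 = 7/8`). -/
def aSeq' (n : ℕ) : ℝ := if n = 0 then 3 / 8 else 1 - 1 / 4 / 2 ^ n

/-- `b'_0 = 1/8` and `b'_n = a'_n` for `n ≥ 1`. -/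
def bSeq' (n : ℕ) : ℝ := if n = 0 then 1 / 8 else aSeq' n

/-- `u(x) = 0` on `[0, 3/8)`, `u(x) = a_n` on `[a'_n, a'_{n+1})`, and `u(1) = 1`. -/
def uAux (x : ℝ) : ℝ :=
  if x = 1 then 1
  else if h : ∃ n : ℕ, aSeq' n ≤ x ∧ x < aSeq' (n + 1) then aSeq h.choose
  else 0

/-- `v(x) = 0` on `[0, 1/8)`, `v(x) = 1/8` on `[1/8, 7/8)`, `v(x) = 5/8` on `[7/8, 15/16)`,
`v(x) = a_{n-1}` on `[b'_n, b'_{n+1})` for `n ≥ 2`, and `v(1) = 1`. -/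
def vAux (x : ℝ) : ℝ :=
  if x = 1 then 1
  else if x < 1 / 8 then 0
  else if x < 7 / 8 then 1 / 8
  else if x < 15 / 16 then 5 / 8
  else if h : ∃ n : ℕ, 2 ≤ n ∧ bSeq' n ≤ x ∧ x < bSeq' (n + 1) then aSeq (h.choose - 1)
  else 0

/-- The fuzzy set `u` of the Example, as a function on `I = [0,1]`. -/
def uEx : I01 → ℝ := fun x => uAux x.1

/-- The fuzzy set `v` of the Example, as a function on `I = [0,1]`. -/
def vEx : I01 → ℝ := fun x => vAux x.1

/-- The piecewise-linear map `t(x) = 3x` on `[0,1/8]`, `t(x) = x/2 + 5/16` on `[1/8,5/8]`,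
`t(x) = x` on `[5/8,1]`. -/
def tEx (x : ℝ) : ℝ :=
  if x ≤ 1 / 8 then 3 * x else if x ≤ 5 / 8 then x / 2 + 5 / 16 else x

lemma aSeq_ge (n : ℕ) : 3 / 8 ≤ aSeq n := by
  have h : (5 / 8 : ℝ) / 2 ^ n ≤ 5 / 8 := div_le_self (by norm_num) (one_le_pow₀ (by norm_num))
  unfold aSeq
  linarith

lemma aSeq'_ge_of_pos {n : ℕ} (hn : n ≠ 0) : 7 / 8 ≤ aSeq' n := by
  have h2 : (2 : ℝ) ^ 1 ≤ 2 ^ n := pow_le_pow_right₀ (by norm_num) (Nat.one_le_iff_ne_zero.2 hn)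
  have h : (1 / 4 : ℝ) / 2 ^ n ≤ 1 / 4 / 2 ^ 1 :=
    div_le_div_of_nonneg_left (by norm_num) (by norm_num) h2
  rw [aSeq', if_neg hn]
  linarith

lemma aSeq'_ge (n : ℕ) : 3 / 8 ≤ aSeq' n := by
  by_cases hn : n = 0
  · simp [aSeq', hn]
  · linarith [aSeq'_ge_of_pos hn]

lemma exists_lt_aSeq' {x : ℝ} (hx : x < 1) : ∃ n, x < aSeq' n := by
  obtain ⟨n, hn⟩ := exists_pow_lt_of_lt_one (sub_pos.2 hx) (by norm_num : (1 / 2 : ℝ) < 1)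
  refine ⟨n + 1, ?_⟩
  have h0 : (0 : ℝ) < (1 / 2) ^ n := by positivity
  have h : (1 / 4 : ℝ) / 2 ^ (n + 1) = (1 / 2) ^ n / 8 := by
    rw [pow_succ, div_pow, one_pow]
    field_simp
    norm_num
  rw [aSeq', if_neg n.succ_ne_zero, h]
  linarith

lemma exists_mem_Ico_aSeq' {x : ℝ} (hx : x < 1) {m : ℕ} (hm : aSeq' m ≤ x) :
    ∃ n, m ≤ n ∧ aSeq' n ≤ x ∧ x < aSeq' (n + 1) := by
  by_contra! H
  have key : ∀ n, m ≤ n → aSeq' n ≤ x := fun n hn =>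
    Nat.le_induction hm (fun k hk ih => H k hk ih) n hn
  have hmono : ∀ n, n ≠ 0 → aSeq' n ≤ aSeq' (n + m) := fun n hn => by
    rw [aSeq', aSeq', if_neg hn, if_neg (by omega)]
    gcongr
    · norm_num
    · omega
  obtain ⟨n, hn⟩ := exists_lt_aSeq' hx
  rcases eq_or_ne n 0 with rfl | h0
  · have := key m le_rfl
    have := aSeq'_ge m
    simp [aSeq'] at hn
    linarith
  · linarith [hmono n h0, key (n + m) (by omega)]

lemma uAux_one : uAux 1 = 1 := by simp [uAux]

lemma uAux_of_lt {x : ℝ} (hx : x < 3 / 8) : uAux x = 0 := by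
  rw [uAux, if_neg (by linarith), dif_neg]
  rintro ⟨n, hn, -⟩
  linarith [aSeq'_ge n]

lemma uAux_ge {x : ℝ} (hx : 3 / 8 ≤ x) (hx1 : x ≤ 1) : 3 / 8 ≤ uAux x := by
  rcases hx1.eq_or_lt with rfl | hlt
  · norm_num [uAux_one]
  obtain ⟨n, -, hn⟩ := exists_mem_Ico_aSeq' hlt (m := 0) (by simpa [aSeq'] using hx)
  rw [uAux, if_neg hlt.ne, dif_pos ⟨n, hn⟩]
  exact aSeq_ge _

lemma uAux_le {x : ℝ} (hx : x < 7 / 8) : uAux x ≤ 3 / 8 := by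
  rw [uAux, if_neg (by linarith)]
  split_ifs with h
  · have h0 : h.choose = 0 := by
      by_contra hne
      linarith [aSeq'_ge_of_pos hne, h.choose_spec.1]
    rw [h0]
    norm_num [aSeq]
  · norm_num

lemma vAux_one : vAux 1 = 1 := by simp [vAux]

lemma vAux_of_lt {x : ℝ} (hx : x < 1 / 8) : vAux x = 0 := by
  rw [vAux, if_neg (by linarith), if_pos hx]

lemma vAux_ge {x : ℝ} (hx : 1 / 8 ≤ x) (hx1 : x ≤ 1) : 1 / 8 ≤ vAux x := by
  rcases hx1.eq_or_lt with rfl | hlt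
  · norm_num [vAux_one]
  rw [vAux, if_neg hlt.ne, if_neg hx.not_gt]
  split_ifs with h1 h2 h3
  · exact le_rfl
  · norm_num
  · linarith [aSeq_ge (h3.choose - 1)]
  · refine absurd ?_ h3
    obtain ⟨n, hn, h⟩ := exists_mem_Ico_aSeq' hlt (m := 2) (by norm_num [aSeq']; linarith)
    exact ⟨n, hn, by simpa [bSeq', show n ≠ 0 by omega] using h⟩

lemma vAux_le {x : ℝ} (hx : x < 7 / 8) : vAux x ≤ 1 / 8 := by
  rw [vAux, if_neg (by linarith)]
  split_ifs <;> norm_num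

lemma tEx_one : tEx 1 = 1 := by norm_num [tEx]

lemma tEx_zero : tEx 0 = 0 := by norm_num [tEx]

lemma tEx_strictMono : StrictMono tEx := by
  intro x y h
  unfold tEx
  split_ifs <;> linarith

lemma tEx_continuous : Continuous tEx := by
  refine Continuous.if_le (by fun_prop)
    (Continuous.if_le (by fun_prop) (by fun_prop) (by fun_prop) (by fun_prop) ?_)
    (by fun_prop) (by fun_prop) ?_
  · rintro x rfl
    norm_num
  · rintro x rfl
    norm_num

lemma tEx_isHomI : IsHomI tEx := by
  refine ⟨tEx_strictMono.strictMonoOn _, tEx_continuous.continuousOn, fun x hx => ?_, ?_⟩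
  · rw [← tEx_zero, ← tEx_one]
    exact ⟨tEx_strictMono.monotone hx.1, tEx_strictMono.monotone hx.2⟩
  · have h := intermediate_value_Icc (zero_le_one' ℝ) tEx_continuous.continuousOn
    rwa [tEx_zero, tEx_one] at h

lemma tEx_eighth : tEx (1 / 8) = 3 / 8 := by norm_num [tEx]

lemma abs_tEx_sub_le {x : ℝ} (hx : x ∈ Icc (0 : ℝ) 1) : |tEx x - x| ≤ 1 / 4 := by
  obtain ⟨h0, h1⟩ := hx
  unfold tEx
  rw [abs_le]
  split_ifs <;> constructor <;> linarith

lemma iSup_abs_tEx_sub : (⨆ x : Icc (0 : ℝ) 1, |tEx x.1 - x.1|) = 1 / 4 := by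
  have : Nonempty (Icc (0 : ℝ) 1) := ⟨⟨0, by simp⟩⟩
  refine le_antisymm (ciSup_le fun x => abs_tEx_sub_le x.2) ?_
  have hb : BddAbove (range fun x : Icc (0 : ℝ) 1 => |tEx x.1 - x.1|) :=
    ⟨1 / 4, by rintro _ ⟨x, rfl⟩; exact abs_tEx_sub_le x.2⟩
  refine le_trans ?_ (le_ciSup hb ⟨1 / 8, by norm_num, by norm_num⟩)
  simp only [tEx_eighth]
  norm_num

/-- Low cuts of a fuzzy set on `I` that vanishes on `[0, c)` and is at least `β` on `[c, 1]`. -/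
lemma fcut_eq_of_le {w : I01 → ℝ} {c β α : ℝ} (hβ : 0 < β) (h0 : ∀ x : I01, x.1 < c → w x = 0)
    (h1 : ∀ x : I01, c ≤ x.1 → β ≤ w x) (hα0 : 0 ≤ α) (hα : α ≤ β) :
    fcut w α = {x | c ≤ x.1} := by
  unfold fcut
  split_ifs with h
  · have hpos : {x | 0 < w x} = {x : I01 | c ≤ x.1} := by
      ext x
      refine ⟨fun hx => ?_, fun hx => hβ.trans_le (h1 x hx)⟩
      by_contra hlt
      exact (ne_of_gt hx) (h0 x (not_le.1 hlt))
    rw [hpos]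
    exact (isClosed_le continuous_const continuous_subtype_val).closure_eq
  · ext x
    refine ⟨fun hx => ?_, fun hx => hα.trans (h1 x hx)⟩
    by_contra hlt
    have hx' : α ≤ w x := hx
    rw [h0 x (not_le.1 hlt)] at hx'
    exact h (le_antisymm hx' hα0)

lemma fcut_uEx {α : ℝ} (h0 : 0 ≤ α) (h : α ≤ 3 / 8) : fcut uEx α = {x | 3 / 8 ≤ x.1} :=
  fcut_eq_of_le (by norm_num) (fun _ hx => uAux_of_lt hx) (fun x hx => uAux_ge hx x.2.2) h0 h

lemma fcut_tEx_vEx {α : ℝ} (h0 : 0 ≤ α) (h : α ≤ 3 / 8) :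
    fcut (tEx ∘ vEx) α = {x | 1 / 8 ≤ x.1} := by
  refine fcut_eq_of_le (by norm_num) (fun x hx => ?_) (fun x hx => ?_) h0 h
  · simp [vEx, vAux_of_lt hx, tEx_zero]
  · rw [← tEx_eighth]
    exact tEx_strictMono.monotone (vAux_ge hx x.2.2)

/-- High cuts are `1 / 8`-close when both fuzzy sets are small on `[0, 7/8)` and attain `1`
at `1`. -/
lemma hausdorffDist_fcut_le_of_lt {w z : I01 → ℝ} {α β : ℝ} (hβ : 0 ≤ β)
    (hw : ∀ x : I01, x.1 < 7 / 8 → w x ≤ β) (hz : ∀ x : I01, x.1 < 7 / 8 → z x ≤ β)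
    (hw1 : w 1 = 1) (hz1 : z 1 = 1) (hα : β < α) (hα1 : α ≤ 1) :
    hausdorffDist (fcut w α) (fcut z α) ≤ 1 / 8 := by
  have hne : α ≠ 0 := (hβ.trans_lt hα).ne'
  have hdist : ∀ y : I01 → ℝ, (∀ x : I01, x.1 < 7 / 8 → y x ≤ β) →
      ∀ x, α ≤ y x → dist x 1 ≤ 1 / 8 := fun y hy x hx => by
    have h : 7 / 8 ≤ x.1 := by
      by_contra hlt
      linarith [hy x (not_le.1 hlt)]
    have h1 := x.2.2
    rw [Subtype.dist_eq, Real.dist_eq, abs_le]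
    constructor <;> simp <;> linarith
  simp only [fcut, if_neg hne]
  exact hausdorffDist_le_of_mem_dist (by norm_num)
    (fun x hx => ⟨1, by simpa [hz1] using hα1, hdist w hw x hx⟩)
    (fun x hx => ⟨1, by simpa [hw1] using hα1, hdist z hz x hx⟩)

/-- The Hausdorff distance between two terminal segments of `I`. -/
lemma hausdorffDist_setOf_le {a b : ℝ} (ha : 0 ≤ a) (hab : a ≤ b) (hb : b ≤ 1) :
    hausdorffDist {x : I01 | b ≤ x.1} {x : I01 | a ≤ x.1} = b - a := by
  let pb : I01 := ⟨b, ha.trans hab, hb⟩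
  let pa : I01 := ⟨a, ha, hab.trans hb⟩
  apply le_antisymm
  · refine hausdorffDist_le_of_mem_dist (sub_nonneg.2 hab)
      (fun x hx => ⟨x, hab.trans hx, by simpa using hab⟩) (fun x hx => ?_)
    rcases le_total b x.1 with h | h
    · exact ⟨x, h, by simpa using hab⟩
    · refine ⟨pb, le_refl b, ?_⟩
      have hx' : a ≤ x.1 := hx
      rw [Subtype.dist_eq, Real.dist_eq, abs_le]
      constructor <;> simp only [pb] <;> linarith
  · refine le_of_forall_gt fun r hr => ?_
    obtain ⟨y, hy, hd⟩ := exists_dist_lt_of_hausdorffDist_lt' (y := pa) (le_refl a) hr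
      (hausdorffEDist_ne_top_of_nonempty_of_bounded ⟨pb, le_refl b⟩ ⟨pa, le_refl a⟩
        (isCompact_univ.isBounded.subset (subset_univ _))
        (isCompact_univ.isBounded.subset (subset_univ _)))
    have hy' : b ≤ y.1 := hy
    rw [Subtype.dist_eq, Real.dist_eq, abs_lt] at hd
    simp only [pa] at hd
    linarith [hd.1, hd.2]

lemma hausdorffDist_fcut_of_le {α : ℝ} (h0 : 0 ≤ α) (h : α ≤ 3 / 8) :
    hausdorffDist (fcut uEx α) (fcut (tEx ∘ vEx) α) = 1 / 4 := by
  rw [fcut_uEx h0 h, fcut_tEx_vEx h0 h,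
    hausdorffDist_setOf_le (by norm_num) (by norm_num) (by norm_num)]
  norm_num

lemma hausdorffDist_fcut_le {α : ℝ} (hα : α ∈ Icc (0 : ℝ) 1) :
    hausdorffDist (fcut uEx α) (fcut (tEx ∘ vEx) α) ≤ 1 / 4 := by
  rcases le_or_gt α (3 / 8) with h | h
  · exact (hausdorffDist_fcut_of_le hα.1 h).le
  · refine (hausdorffDist_fcut_le_of_lt (by norm_num) (fun x hx => uAux_le hx)
      (fun x hx => ?_) uAux_one ?_ h hα.2).trans (by norm_num)
    · rw [← tEx_eighth]
      exact tEx_strictMono.monotone (vAux_le hx)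
    · simp [vEx, vAux_one, tEx_one]

lemma dInfty_uEx_tEx_vEx : dInfty uEx (tEx ∘ vEx) = 1 / 4 := by
  have : Nonempty (Icc (0 : ℝ) 1) := ⟨⟨0, by simp⟩⟩
  refine le_antisymm (ciSup_le fun α => hausdorffDist_fcut_le α.2) ?_
  have hb : BddAbove (range fun α : Icc (0 : ℝ) 1 =>
      hausdorffDist (fcut uEx α.1) (fcut (tEx ∘ vEx) α.1)) :=
    ⟨1 / 4, by rintro _ ⟨α, rfl⟩; exact hausdorffDist_fcut_le α.2⟩
  refine le_trans ?_ (le_ciSup hb ⟨0, by norm_num, by norm_num⟩)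
  exact (hausdorffDist_fcut_of_le le_rfl (by norm_num)).ge

/-- `t ∈ Hom(I)`, `sup{|t(x) - x| : x ∈ I} = 1/4`, and `d_∞(u, t ∘ v) = 1/4`. -/
theorem statement9 :
    IsHomI tEx ∧
    (⨆ x : Icc (0 : ℝ) 1, |tEx x.1 - x.1|) = 1 / 4 ∧
    dInfty uEx (tEx ∘ vEx) = 1 / 4 :=
  ⟨tEx_isHomI, iSup_abs_tEx_sub, dInfty_uEx_tEx_vEx⟩
end
end
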